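/- For all natural numbers n ≥ 2 and 1 ≤ j ≤ n−1, the contour integral (1/(2πi)) ∮_{|t|=1/2} t^(j−1) · (r (n−j) t)² / ((r n t + 2t · r (n−1) t) · (r n t − r (n−1) t)) dt (over the circle of radius 1/2 centered at 0 in ℂ, traversed counterclockwise) equals (−1)^j · p n j, where p n j is viewed as a complex number. In particular the absorption probability of the two-barrier Hadamard walk equals the explicit formula (√2/4)·(A^(n−j) − B^(n−j))·(A^(j−1) + B^(j−1))/(A^(n−1) + B^(n−1)). -/

import Mathlib

open Polynomial

/-- The polynomials `r k ∈ ℤ[X]` defined by `r 0 = 0`, `r 1 = 1`,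
`r (k+2) = (1 - 2X) r (k+1) + X r k`. -/
noncomputable def r : ℕ → Polynomial ℤ
  | 0 => 0
  | 1 => 1
  | (k + 2) => (1 - 2 * X) * r (k + 1) + X * r k

noncomputable def A : ℝ := 2 + Real.sqrt 2
noncomputable def B : ℝ := 2 - Real.sqrt 2

/-- The absorption probability of the two-barrier Hadamard quantum walk on `{0,…,n}`
started at site `j`, given by the explicit formula of Bach–Borisov. -/
noncomputable def p (n j : ℕ) : ℝ :=
  (Real.sqrt 2 / 4) * ((A ^ (n - j) - B ^ (n - j)) * (A ^ (j - 1) + B ^ (j - 1))) /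
    (A ^ (n - 1) + B ^ (n - 1))


open Complex in
theorem circleIntegral_comp_inv_four_mul (f : ℂ → ℂ) :
    (∮ t in C(0, 1 / 2), f (1 / (4 * t)) / (4 * t ^ 2)) = ∮ t in C(0, 1 / 2), f t := by
  simp only [circleIntegral, deriv_circleMap]
  have hsub := intervalIntegral.integral_comp_sub_left (a := 0) (b := 2 * Real.pi)
    (fun θ : ℝ ↦ (circleMap 0 (1 / 2) θ * I) • f (circleMap 0 (1 / 2) θ)) (2 * Real.pi)
  rw [sub_self, sub_zero] at hsub
  rw [← hsub]
  refine intervalIntegral.integral_congr fun θ _ ↦ ?_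
  have hrev : circleMap 0 (1 / 2) (2 * Real.pi - θ) = 1 / (4 * circleMap 0 (1 / 2) θ) := by
    have hexp : exp (θ * I) ≠ 0 := exp_ne_zero _
    simp only [circleMap, zero_add]
    push_cast
    rw [sub_mul, exp_sub, exp_two_pi_mul_I]
    field_simp
    norm_num
  have hne : circleMap 0 (1 / 2) θ ≠ 0 := circleMap_ne_center (by norm_num)
  simp only [hrev, smul_eq_mul]
  field_simp

theorem aeval_r_zero (t : ℂ) : aeval t (r 0) = 0 := by simp [r]

theorem aeval_r_one (t : ℂ) : aeval t (r 1) = 1 := by simp [r]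

theorem aeval_r_add_two (t : ℂ) (k : ℕ) :
    aeval t (r (k + 2)) = (1 - 2 * t) * aeval t (r (k + 1)) + t * aeval t (r k) := by
  simp only [r, map_add, map_mul, map_sub, map_one, map_ofNat, aeval_X]

/-- An identity of Ocagne type. -/
theorem aeval_r_mul_sub_mul (t : ℂ) (m i : ℕ) :
    aeval t (r (i + m)) * aeval t (r (i + 1)) - aeval t (r (i + m + 1)) * aeval t (r i) =
      (-t) ^ i * aeval t (r m) := by
  induction i with
  | zero => simp [aeval_r_zero, aeval_r_one]
  | succ i ih =>
    rw [show i + 1 + m + 1 = i + m + 2 by ring, show i + 1 + m = i + m + 1 by ring,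
      show i + 1 + 1 = i + 2 by ring, aeval_r_add_two t (i + m), aeval_r_add_two t i, pow_succ]
    linear_combination (-t) * ih

theorem aeval_r_reflect {s t : ℂ} (hst : 4 * s * t = 1) (k : ℕ) :
    (-2 * t) ^ k * aeval s (r (k + 1)) = aeval t (r (k + 1)) := by
  induction k using Nat.twoStepInduction with
  | zero => simp [aeval_r_one]
  | one =>
    simp only [show 1 + 1 = 0 + 2 from rfl, aeval_r_add_two, zero_add, aeval_r_one, aeval_r_zero]
    linear_combination hst
  | more k ih₀ ih₁ =>
    rw [show k + 2 + 1 = k + 1 + 2 by ring, aeval_r_add_two s, aeval_r_add_two t,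
      ← ih₁, ← ih₀, show k + 1 + 1 = k + 2 by ring]
    linear_combination
      ((-2 * t) ^ (k + 1) * aeval s (r (k + 2)) + t * (-2 * t) ^ k * aeval s (r (k + 1))) * hst

theorem aeval_r_add_reflect {s t : ℂ} (hst : 4 * s * t = 1) (k : ℕ) :
    (-2 * t) ^ k * (aeval s (r (k + 1)) + 2 * s * aeval s (r k)) =
      aeval t (r (k + 1)) - aeval t (r k) := by
  cases k with
  | zero => simp [aeval_r_zero, aeval_r_one]
  | succ k =>
    rw [← aeval_r_reflect hst (k + 1), ← aeval_r_reflect hst k]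
    linear_combination (-(-2 * t) ^ k * aeval s (r (k + 1))) * hst

theorem aeval_r_add_two_mul_ne_zero {t : ℂ} (ht : ‖t‖ ≤ 1 / 2) (k : ℕ) :
    aeval t (r (k + 1)) + 2 * t * aeval t (r k) ≠ 0 := by
  set d : ℕ → ℂ := fun k ↦ aeval t (r (k + 1)) + 2 * t * aeval t (r k) with hd
  have hrec (k : ℕ) : d (k + 2) = (1 - 2 * t) * d (k + 1) + t * d k := by
    simp only [hd]
    rw [show k + 2 + 1 = k + 1 + 2 by ring, aeval_r_add_two t (k + 1), aeval_r_add_two t k]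
    ring
  have hcone (k : ℕ) : 2 * Complex.normSq (d (k + 1) - d k) < Complex.normSq (d k) := by
    induction k with
    | zero =>
      simp only [hd, show 0 + 1 + 1 = 0 + 2 from rfl, aeval_r_add_two, zero_add, aeval_r_one,
        aeval_r_zero]
      simp
    | succ k ih =>
      have hstep : d (k + 1 + 1) - d (k + 1) = -t * (2 * d (k + 1) - d k) := by
        rw [hrec]; ring
      have ht2 : Complex.normSq t ≤ 1 / 4 := by
        rw [Complex.normSq_eq_norm_sq]
        nlinarith [norm_nonneg t]
      rw [hstep, Complex.normSq_mul, Complex.normSq_neg]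
      have hbound := mul_le_mul_of_nonneg_right ht2 (Complex.normSq_nonneg (2 * d (k + 1) - d k))
      refine lt_of_le_of_lt (mul_le_mul_of_nonneg_left hbound zero_le_two) ?_
      simp only [Complex.normSq_apply, Complex.sub_re, Complex.sub_im, Complex.mul_re,
        Complex.mul_im, Complex.re_ofNat, Complex.im_ofNat] at ih ⊢
      linarith
  have hpos : 0 < Complex.normSq (d k) :=
    (mul_nonneg zero_le_two (Complex.normSq_nonneg _)).trans_lt (hcone k)
  exact Complex.normSq_pos.mp hpos

theorem aeval_r_neg_half (k : ℕ) :
    (Real.sqrt 2 : ℂ) * 2 ^ k * aeval (-1 / 2 : ℂ) (r k) = (A : ℂ) ^ k - (B : ℂ) ^ k := by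
  have hsq : (Real.sqrt 2 : ℂ) ^ 2 = 2 := by
    exact_mod_cast congrArg ((↑) : ℝ → ℂ) (Real.sq_sqrt zero_le_two)
  simp only [A, B]
  push_cast
  induction k using Nat.twoStepInduction with
  | zero => simp [aeval_r_zero]
  | one => simp [aeval_r_one]; ring
  | more k ih₀ ih₁ =>
    rw [aeval_r_add_two]
    linear_combination 4 * ih₁ - 2 * ih₀ -
      ((2 + (Real.sqrt 2 : ℂ)) ^ k - (2 - (Real.sqrt 2 : ℂ)) ^ k) * hsq

theorem aeval_r_add_neg_half (k : ℕ) :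
    2 ^ (k + 1) * (aeval (-1 / 2 : ℂ) (r (k + 1)) + 2 * (-1 / 2) * aeval (-1 / 2 : ℂ) (r k)) =
      (A : ℂ) ^ k + (B : ℂ) ^ k := by
  have hne : (Real.sqrt 2 : ℂ) ≠ 0 := by simp
  have h₁ := aeval_r_neg_half (k + 1)
  have h₀ := aeval_r_neg_half k
  refine mul_left_cancel₀ hne ?_
  have hA : (A : ℂ) = 2 + Real.sqrt 2 := by simp [A]
  have hB : (B : ℂ) = 2 - Real.sqrt 2 := by simp [B]
  rw [pow_succ, pow_succ] at h₁
  linear_combination h₁ - 2 * h₀ + (A : ℂ) ^ k * hA - (B : ℂ) ^ k * hB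

/-- On the circle the integrand splits into a function holomorphic on the closed disc, its
pullback under `t ↦ 1 / (4 * t)`, and a simple pole at `0`. -/
theorem integrand_eq {U : ℂ → ℂ} {K : ℂ} {i k : ℕ}
    (hU : ∀ t, (1 + 2 * t) * U t =
      aeval t (r (k + 1)) * (aeval t (r (i + 1)) + 2 * t * aeval t (r i)) -
        K * (aeval t (r (i + (k + 1) + 1)) + 2 * t * aeval t (r (i + (k + 1)))))
    {t : ℂ} (ht : ‖t‖ = 1 / 2) (ht' : t ≠ -1 / 2) :
    t ^ i * aeval t (r (k + 1)) ^ 2 /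
        ((aeval t (r (i + (k + 1) + 1)) + 2 * t * aeval t (r (i + (k + 1)))) *
          (aeval t (r (i + (k + 1) + 1)) - aeval t (r (i + (k + 1))))) =
      (-1) ^ (i + 1) *
        (U t / (aeval t (r (i + (k + 1) + 1)) + 2 * t * aeval t (r (i + (k + 1)))) +
          U (1 / (4 * t)) / (aeval (1 / (4 * t)) (r (i + (k + 1) + 1)) +
            2 * (1 / (4 * t)) * aeval (1 / (4 * t)) (r (i + (k + 1)))) / (4 * t ^ 2) +
          K / 2 * t⁻¹) := by
  have ht0 : t ≠ 0 := by
    rintro rfl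
    norm_num at ht
  set s := 1 / (4 * t) with hs
  have hst : 4 * s * t = 1 := by rw [hs]; field_simp
  have hsnorm : ‖s‖ ≤ 1 / 2 := by
    rw [hs, norm_div, norm_mul, ht]
    norm_num
  have hy := aeval_r_add_two_mul_ne_zero ht.le (i + (k + 1))
  have hys := aeval_r_add_two_mul_ne_zero hsnorm (i + (k + 1))
  have href := aeval_r_add_reflect hst (i + (k + 1))
  have hrefi := aeval_r_add_reflect hst i
  have hrefP := aeval_r_reflect hst k
  have hdoc := aeval_r_mul_sub_mul t (k + 1) i
  have hUt := hU t
  have hUs := hU s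
  have h2t : 1 + 2 * t ≠ 0 := fun h ↦ ht' (by linear_combination h / 2)
  have hpow : (-2 * t) ^ (i + (k + 1)) ≠ 0 := pow_ne_zero _ (by simpa using ht0)
  set a := aeval t (r (k + 1))
  set x := aeval t (r (i + 1)) + 2 * t * aeval t (r i) with hx
  set e := aeval t (r (i + 1)) - aeval t (r i) with he
  set y := aeval t (r (i + (k + 1) + 1)) + 2 * t * aeval t (r (i + (k + 1))) with hy_def
  set f := aeval t (r (i + (k + 1) + 1)) - aeval t (r (i + (k + 1))) with hf_def
  set ys := aeval s (r (i + (k + 1) + 1)) + 2 * s * aeval s (r (i + (k + 1)))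
  have hf : f ≠ 0 := href ▸ mul_ne_zero hpow hys
  have hsplit : (-t) ^ i * a * (1 + 2 * t) = y * e - f * x := by
    rw [← hdoc, hx, he, hy_def, hf_def]
    ring
  clear_value a x e y f ys
  have hUt' : U t = (a * x - K * y) / (1 + 2 * t) := by
    rw [← hUt]; field_simp
  have hUs' : U s / ys / (4 * t ^ 2) =
      ((-2 * t) * a * e - K * f) / (f * (1 + 2 * t) * (2 * t)) := by
    have hmul : (1 + 2 * t) * (U s * (-2 * t) ^ (i + (k + 1))) =
        2 * t * ((-2 * t) * a * e - K * f) := by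
      rw [← href, ← hrefi, ← hrefP]
      rw [pow_add, pow_succ (-2 * t) k]
      linear_combination 2 * t * (-2 * t) ^ i * (-2 * t) ^ k * (-2 * t) * hUs -
        (-2 * t) ^ i * (-2 * t) ^ k * (-2 * t) * U s * hst
    rw [div_div, div_eq_div_iff (mul_ne_zero hys (by simpa using ht0))
      (mul_ne_zero (mul_ne_zero hf h2t) (by simpa using ht0))]
    linear_combination 2 * t * ys * hmul - U s * (1 + 2 * t) * (2 * t) * href
  rw [hUt', hUs']
  have hsign : t ^ i = (-1) ^ i * (-t) ^ i := by rw [← mul_pow]; simp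
  have hterm : t ^ i * a ^ 2 = (-1) ^ i * a * ((y * e - f * x) / (1 + 2 * t)) := by
    rw [← hsplit, mul_div_cancel_right₀ _ h2t, hsign]
    ring
  rw [hterm, pow_succ]
  field_simp
  ring

theorem circleIntegral_eq_of_factor {U : ℂ[X]} {K : ℂ} {i k : ℕ}
    (hU : ∀ t, (1 + 2 * t) * U.eval t =
      aeval t (r (k + 1)) * (aeval t (r (i + 1)) + 2 * t * aeval t (r i)) -
        K * (aeval t (r (i + (k + 1) + 1)) + 2 * t * aeval t (r (i + (k + 1))))) :
    (∮ t in C(0, 1 / 2), t ^ i * aeval t (r (k + 1)) ^ 2 /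
        ((aeval t (r (i + (k + 1) + 1)) + 2 * t * aeval t (r (i + (k + 1)))) *
          (aeval t (r (i + (k + 1) + 1)) - aeval t (r (i + (k + 1)))))) =
      (-1) ^ (i + 1) * (K / 2 * (2 * Real.pi * Complex.I)) := by
  set h : ℂ → ℂ := fun t ↦ U.eval t /
    (aeval t (r (i + (k + 1) + 1)) + 2 * t * aeval t (r (i + (k + 1))))
  have hdiff {t : ℂ} (ht : ‖t‖ ≤ 1 / 2) : DifferentiableAt ℂ h t := by
    refine U.differentiableAt.div ?_ (aeval_r_add_two_mul_ne_zero ht _)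
    exact (Polynomial.differentiableAt_aeval _).add
      ((differentiableAt_id.const_mul 2).mul (Polynomial.differentiableAt_aeval _))
  have hzero : (∮ t in C(0, 1 / 2), h t) = 0 := by
    refine Complex.circleIntegral_eq_zero_of_differentiable_on_off_countable (by norm_num)
      Set.countable_empty (fun t ht ↦ ?_) (fun t ht ↦ ?_)
    · exact (hdiff (by simpa using ht)).continuousAt.continuousWithinAt
    · exact hdiff (by simpa using (Metric.ball_subset_closedBall ht.1))
  have hne {t : ℂ} (ht : t ∈ Metric.sphere (0 : ℂ) (1 / 2)) : t ≠ 0 := by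
    rintro rfl
    norm_num at ht
  have hh_int : CircleIntegrable h 0 (1 / 2) :=
    ContinuousOn.circleIntegrable (by norm_num) fun t ht ↦
      (hdiff (by simpa using (Metric.sphere_subset_closedBall ht))).continuousAt.continuousWithinAt
  have hh_int' : CircleIntegrable (fun t ↦ h (1 / (4 * t)) / (4 * t ^ 2)) 0 (1 / 2) := by
    refine ContinuousOn.circleIntegrable (by norm_num) fun t ht ↦
      ContinuousAt.continuousWithinAt ?_
    have ht0 := hne ht
    have hmap : ContinuousAt (fun t : ℂ ↦ 1 / (4 * t)) t :=
      continuousAt_const.div (continuousAt_const.mul continuousAt_id) (by simpa using ht0)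
    have hnorm : ‖1 / (4 * t)‖ ≤ 1 / 2 := by
      rw [mem_sphere_zero_iff_norm] at ht
      rw [norm_div, norm_mul, ht]
      norm_num
    refine ContinuousAt.div ?_ (by fun_prop) (by simpa using ht0)
    exact ContinuousAt.comp (f := fun t : ℂ ↦ 1 / (4 * t)) (hdiff hnorm).continuousAt hmap
  have hpole : CircleIntegrable (fun t ↦ K / 2 * t⁻¹) 0 (1 / 2) := by
    refine ContinuousOn.circleIntegrable (by norm_num) fun t ht ↦ ?_
    exact (continuousAt_const.mul (continuousAt_inv₀ (hne ht))).continuousWithinAt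
  have hpole_eq : (∮ t in C(0, 1 / 2), K / 2 * t⁻¹) = K / 2 * (2 * Real.pi * Complex.I) := by
    rw [circleIntegral.integral_const_mul]
    have hinv := circleIntegral.integral_sub_center_inv (0 : ℂ) (R := 1 / 2) (by norm_num)
    simp only [sub_zero] at hinv
    rw [hinv]
  have hcongr : (∮ t in C(0, 1 / 2), t ^ i * aeval t (r (k + 1)) ^ 2 /
        ((aeval t (r (i + (k + 1) + 1)) + 2 * t * aeval t (r (i + (k + 1)))) *
          (aeval t (r (i + (k + 1) + 1)) - aeval t (r (i + (k + 1)))))) =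
      ∮ t in C(0, 1 / 2), (-1) ^ (i + 1) *
        (h t + h (1 / (4 * t)) / (4 * t ^ 2) + K / 2 * t⁻¹) := by
    have hcount : (circleMap 0 (1 / 2) ⁻¹' {(-1 / 2 : ℂ)}).Countable :=
      (Set.countable_singleton _).preimage_circleMap 0 (by norm_num)
    refine intervalIntegral.integral_congr_ae
      ((hcount.ae_notMem _).mono fun θ hθ _ ↦ congrArg _ ?_)
    exact integrand_eq hU (by simp) hθ
  rw [hcongr, circleIntegral.integral_const_mul,
    circleIntegral.integral_add (f := fun t ↦ h t + h (1 / (4 * t)) / (4 * t ^ 2))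
      (hh_int.add hh_int') hpole,
    circleIntegral.integral_add hh_int hh_int', circleIntegral_comp_inv_four_mul, hzero, hpole_eq]
  ring

theorem exists_one_add_two_mul_eval_eq {P : ℂ[X]} (hP : P.eval (-1 / 2) = 0) :
    ∃ U : ℂ[X], ∀ t, (1 + 2 * t) * U.eval t = P.eval t := by
  obtain ⟨Q, rfl⟩ := dvd_iff_isRoot.mpr hP
  refine ⟨C (1 / 2) * Q, fun t ↦ ?_⟩
  simp only [eval_mul, eval_C, eval_sub, eval_X]
  ring

/-- The contour integral `(1/(2πi)) ∮_{|t|=1/2} t^{j-1} r_{n-j}(t)² /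
((r_n(t) + 2t r_{n-1}(t))(r_n(t) - r_{n-1}(t))) dt` equals `(-1)^j p n j`,
where `p n j` is the explicit absorption probability of the two-barrier
Hadamard quantum walk. -/
theorem circleIntegral_eq_absorption_probability (n j : ℕ) (hn : 2 ≤ n)
    (hj : 1 ≤ j) (hjn : j ≤ n - 1) :
    (1 / (2 * (Real.pi : ℂ) * Complex.I)) *
      (∮ t in C(0, 1 / 2),
        t ^ (j - 1) * (Polynomial.aeval t (r (n - j))) ^ 2 /
          ((Polynomial.aeval t (r n) + 2 * t * Polynomial.aeval t (r (n - 1))) *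
            (Polynomial.aeval t (r n) - Polynomial.aeval t (r (n - 1))))) =
      (-1) ^ j * (p n j : ℂ) := by
  obtain ⟨i, rfl⟩ := Nat.exists_eq_add_of_le' hj
  obtain ⟨k, rfl⟩ : ∃ k, n = i + (k + 1) + 1 := ⟨n - i - 2, by omega⟩
  rw [show i + (k + 1) + 1 - (i + 1) = k + 1 by omega, Nat.add_sub_cancel, Nat.add_sub_cancel]
  have hden := aeval_r_add_two_mul_ne_zero (t := -1 / 2) (by norm_num) (i + (k + 1))
  have hP := aeval_r_neg_half (k + 1)
  have hj_val := aeval_r_add_neg_half i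
  have hn_val := aeval_r_add_neg_half (i + (k + 1))
  set ρ := aeval (-1 / 2 : ℂ) (r (k + 1)) with hρ
  set x := aeval (-1 / 2 : ℂ) (r (i + 1)) + 2 * (-1 / 2) * aeval (-1 / 2 : ℂ) (r i) with hx
  set y := aeval (-1 / 2 : ℂ) (r (i + (k + 1) + 1)) +
    2 * (-1 / 2) * aeval (-1 / 2 : ℂ) (r (i + (k + 1))) with hy
  let q (l : ℕ) : ℂ[X] := (r l).map (algebraMap ℤ ℂ)
  obtain ⟨U, hU⟩ := exists_one_add_two_mul_eval_eq
    (P := q (k + 1) * (q (i + 1) + 2 * X * q i) -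
      C (ρ * x / y) * (q (i + (k + 1) + 1) + 2 * X * q (i + (k + 1)))) (by
      simp only [q, eval_sub, eval_mul, eval_add, eval_C, eval_X, eval_ofNat,
        eval_map_algebraMap]
      rw [← hρ, ← hx, ← hy, div_mul_cancel₀ _ hden, sub_self])
  simp only [q, eval_sub, eval_mul, eval_add, eval_C, eval_X, eval_ofNat,
    eval_map_algebraMap] at hU
  rw [circleIntegral_eq_of_factor hU]
  have hp : (p (i + (k + 1) + 1) (i + 1) : ℂ) = ρ * x / y / 2 := by
    have hsq : (Real.sqrt 2 : ℂ) ^ 2 = 2 := by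
      exact_mod_cast congrArg ((↑) : ℝ → ℂ) (Real.sq_sqrt zero_le_two)
    simp only [p, show i + (k + 1) + 1 - (i + 1) = k + 1 by omega, Nat.add_sub_cancel]
    push_cast
    rw [← hP, ← hj_val, ← hn_val, show i + (k + 1) + 1 = (k + 1) + (i + 1) by ring,
      pow_add 2 (k + 1)]
    field_simp
    linear_combination 2 * ρ * x * hsq
  rw [hp]
  have hpi : (Real.pi : ℂ) ≠ 0 := by simp [Real.pi_ne_zero]
  field_simp
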